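/- arXiv:1307.5836 — 3 statements merged into one kernel-verified Lean document; each statement's English description precedes it below -/
import Mathlib

section
/- Let A be a C*-algebra and a, b positive elements with a ≤ b. Then b^(1/4) is a factor of a^(1/2): there exists x ∈ A with a^(1/2) = x * b^(1/4). -/
open scoped NNReal

open Filter Topology

section Domination

variable {A : Type*} [NonUnitalCStarAlgebra A] [PartialOrder A] [StarOrderedRing A]

lemma norm_le_norm_of_star_mul_self_le {c s : A} (h : star c * c ≤ star s * s) : ‖c‖ ≤ ‖s‖ := by
  have key := CStarAlgebra.norm_le_norm_of_nonneg_of_le (star_mul_self_nonneg c) h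
  rw [CStarRing.norm_star_mul_self, CStarRing.norm_star_mul_self] at key
  exact abs_le_of_sq_le_sq' (by nlinarith) (norm_nonneg s) |>.2

lemma norm_mul_le_norm_mul_of_star_mul_self_le {c s : A} (h : star c * c ≤ star s * s) (d : A) :
    ‖c * d‖ ≤ ‖s * d‖ := by
  apply norm_le_norm_of_star_mul_self_le
  simpa only [star_mul, mul_assoc] using star_left_conjugate_le_conjugate h d

lemma norm_sub_mul_le_norm_sub_mul_of_star_mul_self_le {c s : A} (h : star c * c ≤ star s * s)
    (e : A) : ‖c - c * e‖ ≤ ‖s - s * e‖ := by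
  apply norm_le_norm_of_star_mul_self_le
  obtain ⟨r, hr⟩ := CStarAlgebra.nonneg_iff_eq_star_mul_self.mp (sub_nonneg.mpr h)
  have key : star (s - s * e) * (s - s * e) - star (c - c * e) * (c - c * e)
      = star (r - r * e) * (r - r * e) := by
    have expand (y : A) : star (y - y * e) * (y - y * e) =
        star y * y - star y * y * e - star e * (star y * y) + star e * (star y * y) * e := by
      simp only [star_sub, star_mul]
      noncomm_ring
    rw [expand, expand, expand, ← hr]
    noncomm_ring
  rw [← sub_nonneg, key]
  exact star_mul_self_nonneg _

end Domination

section ApproximateInverse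

variable {A : Type*} [NonUnitalCStarAlgebra A]

lemma continuous_div_sq_add_sq {η : ℝ} (hη : 0 < η) :
    Continuous fun u : ℝ ↦ u / (u ^ 2 + η ^ 2) :=
  continuous_id.div (by fun_prop) fun u ↦ by positivity

lemma norm_sub_mul_self_mul_cfcₙ_le {q : A} (hq : IsSelfAdjoint q) {η : ℝ} (hη : 0 < η) :
    ‖q - q * q * cfcₙ (fun u : ℝ ↦ u / (u ^ 2 + η ^ 2)) q‖ ≤ η := by
  have hg : ContinuousOn (fun u : ℝ ↦ u / (u ^ 2 + η ^ 2)) (quasispectrum ℝ q) :=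
    (continuous_div_sq_add_sq hη).continuousOn
  have h : q - q * q * cfcₙ (fun u : ℝ ↦ u / (u ^ 2 + η ^ 2)) q =
      cfcₙ (fun u : ℝ ↦ u - u * u * (u / (u ^ 2 + η ^ 2))) q := by
    rw [cfcₙ_sub (fun u : ℝ ↦ u) (fun u ↦ u * u * (u / (u ^ 2 + η ^ 2))) q,
      cfcₙ_mul (fun u : ℝ ↦ u * u) (fun u ↦ u / (u ^ 2 + η ^ 2)) q,
      cfcₙ_mul (fun u : ℝ ↦ u) (fun u ↦ u) q, cfcₙ_id' ℝ q]
  rw [h]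
  refine norm_cfcₙ_le fun u _ ↦ ?_
  have hpos : 0 < u ^ 2 + η ^ 2 := by positivity
  have : u - u * u * (u / (u ^ 2 + η ^ 2)) = η ^ 2 * u / (u ^ 2 + η ^ 2) := by
    field_simp; ring
  rw [this, Real.norm_eq_abs, abs_div, abs_of_pos hpos, div_le_iff₀ hpos, abs_mul,
    abs_of_pos (pow_pos hη 2), ← sq_abs u]
  nlinarith [mul_nonneg hη.le (sq_nonneg (|u| - η)), mul_nonneg hη.le (abs_nonneg u),
    mul_nonneg hη.le (sq_nonneg |u|), pow_pos hη 3]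

lemma norm_mul_self_sub_mul_self_mul_cfcₙ_mul_le {q : A} (hq : IsSelfAdjoint q) {η : ℝ}
    (hη : 0 < η) :
    ‖q * q - q * q * (cfcₙ (fun u : ℝ ↦ u / (u ^ 2 + η ^ 2)) q * q)‖ ≤ η * ‖q‖ := by
  rw [← mul_assoc, ← sub_mul]
  exact (norm_mul_le _ _).trans
    (mul_le_mul_of_nonneg_right (norm_sub_mul_self_mul_cfcₙ_le hq hη) (norm_nonneg q))

end ApproximateInverse

/-- If `c⋆c ≤ q⁴` with `q` self-adjoint, then `q` is a right factor of `c`. -/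
theorem exists_eq_mul_of_star_mul_self_le {A : Type*} [NonUnitalCStarAlgebra A] [PartialOrder A]
    [StarOrderedRing A] {c q : A} (hq : IsSelfAdjoint q)
    (h : star c * c ≤ star (q * q) * (q * q)) : ∃ x : A, c = x * q := by
  let η (n : ℕ) : ℝ := 1 / ((n : ℝ) + 1)
  have hη_pos (n : ℕ) : 0 < η n := Nat.one_div_pos_of_nat
  have hη : Tendsto η atTop (𝓝 0) := tendsto_one_div_add_atTop_nhds_zero_nat
  let d (n : ℕ) : A := cfcₙ (fun u : ℝ ↦ u / (u ^ 2 + η n ^ 2)) q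
  have hsd : Tendsto (fun n ↦ q * q * d n) atTop (𝓝 q) := by
    rw [tendsto_iff_norm_sub_tendsto_zero]
    refine squeeze_zero (fun n ↦ norm_nonneg _) (fun n ↦ ?_) hη
    rw [norm_sub_rev]
    exact norm_sub_mul_self_mul_cfcₙ_le hq (hη_pos n)
  have hcd : CauchySeq fun n ↦ c * d n := by
    refine Metric.cauchySeq_iff.mpr fun ε hε ↦ ?_
    obtain ⟨N, hN⟩ := Metric.cauchySeq_iff.mp hsd.cauchySeq ε hε
    refine ⟨N, fun m hm n hn ↦ lt_of_le_of_lt ?_ (hN m hm n hn)⟩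
    rw [dist_eq_norm, dist_eq_norm, ← mul_sub, ← mul_sub]
    exact norm_mul_le_norm_mul_of_star_mul_self_le h _
  obtain ⟨x, hx⟩ := cauchySeq_tendsto_of_complete hcd
  refine ⟨x, tendsto_nhds_unique ?_ (hx.mul_const q)⟩
  rw [tendsto_iff_norm_sub_tendsto_zero]
  refine squeeze_zero (fun n ↦ norm_nonneg _) (fun n ↦ ?_) (by simpa using hη.mul_const ‖q‖)
  rw [norm_sub_rev, mul_assoc]
  exact (norm_sub_mul_le_norm_sub_mul_of_star_mul_self_le h _).trans
    (norm_mul_self_sub_mul_self_mul_cfcₙ_mul_le hq (hη_pos n))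

/-- If `0 ≤ a ≤ b` in a C*-algebra, then `b^(1/4)` is a factor of `a^(1/2)`:
there is `x` with `√a = x * √(√b)`. -/
theorem stmt_1 {A : Type*} [NonUnitalCStarAlgebra A] [PartialOrder A] [StarOrderedRing A]
    (a b : A) (ha : 0 ≤ a) (hb : 0 ≤ b) (hab : a ≤ b) :
    ∃ x : A, CFC.sqrt a = x * CFC.sqrt (CFC.sqrt b) := by
  apply exists_eq_mul_of_star_mul_self_le (CFC.sqrt_nonneg _).isSelfAdjoint
  rw [CFC.sqrt_mul_sqrt_self _ (CFC.sqrt_nonneg b), (CFC.sqrt_nonneg a).isSelfAdjoint.star_eq,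
    (CFC.sqrt_nonneg b).isSelfAdjoint.star_eq, CFC.sqrt_mul_sqrt_self a, CFC.sqrt_mul_sqrt_self b]
  exact hab
end

section
/- Let J be a closed two-sided ideal of a C*-algebra A. Then J is essential (J ∩ I ≠ {0} for every nonzero closed two-sided ideal I of A) if and only if for every nonzero positive element b ∈ A there exists x ∈ J with 0 < x ≤ b (x positive, nonzero, and x ≤ b). -/
namespace TwoSidedIdeal

/-- The left annihilator of a two-sided ideal, as a two-sided ideal. -/
def leftAnnihilator {R : Type*} [NonUnitalRing R] (J : TwoSidedIdeal R) : TwoSidedIdeal R :=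
  .mk' {a | ∀ j ∈ J, a * j = 0} (fun _ _ ↦ zero_mul _)
    (fun hx hy j hj ↦ by rw [add_mul, hx j hj, hy j hj, add_zero])
    (fun hx j hj ↦ by rw [neg_mul, hx j hj, neg_zero])
    (fun hy j hj ↦ by rw [mul_assoc, hy j hj, mul_zero])
    (fun {_ y} hx j hj ↦ by rw [mul_assoc, hx _ (J.mul_mem_left y j hj)])

theorem mem_leftAnnihilator {R : Type*} [NonUnitalRing R] {J : TwoSidedIdeal R} {a : R} :
    a ∈ J.leftAnnihilator ↔ ∀ j ∈ J, a * j = 0 := by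
  simp [leftAnnihilator]

theorem isClosed_leftAnnihilator {R : Type*} [NonUnitalRing R] [TopologicalSpace R] [T1Space R]
    [ContinuousMul R] (J : TwoSidedIdeal R) : IsClosed (J.leftAnnihilator : Set R) := by
  have h : (J.leftAnnihilator : Set R) = ⋂ j ∈ J, (fun a ↦ a * j) ⁻¹' {0} := by
    ext a
    simp [mem_leftAnnihilator]
  rw [h]
  exact isClosed_biInter fun j _ ↦ isClosed_singleton.preimage (continuous_mul_const j)

end TwoSidedIdeal

theorem CStarRing.eq_zero_of_mul_star_mul_self_eq_zero {A : Type*} [NonUnitalCStarAlgebra A]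
    {x : A} (h : x * star x * x = 0) : x = 0 := by
  rw [← CStarRing.mul_star_self_eq_zero_iff, ← CStarRing.mul_star_self_eq_zero_iff,
    star_mul, star_star, ← mul_assoc, h, zero_mul]

/-- If `0 ≤ x ≤ b` and `x * b = 0`, then `x = 0`. -/
theorem CStarAlgebra.eq_zero_of_le_of_mul_eq_zero {A : Type*} [NonUnitalCStarAlgebra A]
    [PartialOrder A] [StarOrderedRing A] {x b : A} (hx : 0 ≤ x) (hxb : x ≤ b) (h : x * b = 0) :
    x = 0 := by
  have hsa : star x = x := (IsSelfAdjoint.of_nonneg hx).star_eq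
  have hle : star x * x * x ≤ star x * b * x := star_left_conjugate_le_conjugate hxb x
  have hnonneg : 0 ≤ star x * x * x := star_left_conjugate_nonneg hx x
  rw [hsa] at hle hnonneg
  rw [h, zero_mul] at hle
  apply CStarRing.eq_zero_of_mul_star_mul_self_eq_zero
  rw [hsa]
  exact le_antisymm hle hnonneg

/-- A closed two-sided ideal `J` of a C*-algebra `A` is essential (it meets every nonzero
closed two-sided ideal nontrivially) iff every nonzero positive `b ∈ A` dominates some
nonzero positive `x ∈ J` with `0 < x ≤ b`. -/
theorem stmt_6 {A : Type*} [NonUnitalCStarAlgebra A] [PartialOrder A] [StarOrderedRing A]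
    (J : TwoSidedIdeal A) (hJ : IsClosed (J : Set A)) :
    (∀ I : TwoSidedIdeal A, IsClosed (I : Set A) → I ≠ ⊥ → ∃ x, x ∈ J ∧ x ∈ I ∧ x ≠ 0) ↔
      ∀ b : A, 0 ≤ b → b ≠ 0 → ∃ x ∈ J, 0 < x ∧ x ≤ b := by
  constructor
  · intro hess b hb hb0
    set c := CFC.sqrt b
    have hcc : c * c = b := CFC.sqrt_mul_sqrt_self b hb
    have hsa : star c = c := (IsSelfAdjoint.of_nonneg (CFC.sqrt_nonneg b)).star_eq
    have hann : J.leftAnnihilator = ⊥ := by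
      by_contra hne
      obtain ⟨x, hxJ, hxI, hx0⟩ := hess _ J.isClosed_leftAnnihilator hne
      apply hx0
      apply CStarRing.eq_zero_of_mul_star_mul_self_eq_zero
      rw [mul_assoc]
      exact TwoSidedIdeal.mem_leftAnnihilator.1 hxI _ (J.mul_mem_left _ _ hxJ)
    have hc : c ∉ J.leftAnnihilator := by
      rw [hann, TwoSidedIdeal.mem_bot]
      rintro hc0
      exact hb0 (by rw [← hcc, hc0, zero_mul])
    simp only [TwoSidedIdeal.mem_leftAnnihilator, not_forall] at hc
    obtain ⟨j, hj, hcj⟩ := hc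
    have hj0 : j ≠ 0 := by
      rintro rfl
      exact hcj (mul_zero c)
    have hpos : 0 < ‖j * star j‖ :=
      norm_pos_iff.2 fun h ↦ hj0 (CStarRing.mul_star_self_eq_zero_iff j |>.1 h)
    have hsq : c * (j * star j) * c = c * j * star (c * j) := by
      rw [star_mul, hsa]
      simp only [mul_assoc]
    have hle : c * (j * star j) * c ≤ ‖j * star j‖ • b := by
      have := CStarAlgebra.star_left_conjugate_le_norm_smul (a := c) (b := j * star j)
      rwa [hsa, hcc] at this
    refine ⟨‖j * star j‖⁻¹ • (c * (j * star j) * c), ?_, ?_, ?_⟩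
    · rw [← smul_mul_assoc, ← smul_mul_assoc]
      exact J.mul_mem_right _ _ (J.mul_mem_left _ _ (J.mul_mem_right _ _ hj))
    · refine lt_of_le_of_ne (smul_nonneg (inv_nonneg.2 hpos.le) ?_) (Ne.symm ?_)
      · rw [hsq]
        exact mul_star_self_nonneg _
      · rw [hsq]
        exact smul_ne_zero (inv_ne_zero hpos.ne')
          fun h ↦ hcj (CStarRing.mul_star_self_eq_zero_iff _ |>.1 h)
    · calc _ ≤ ‖j * star j‖⁻¹ • ‖j * star j‖ • b :=
            smul_le_smul_of_nonneg_left hle (inv_nonneg.2 hpos.le)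
        _ = b := inv_smul_smul₀ hpos.ne' b
  · intro h I _ hI
    obtain ⟨a, haI, ha0⟩ : ∃ a ∈ I, a ≠ 0 := by
      by_contra! hzero
      exact hI (le_bot_iff.1 fun a ha ↦ (TwoSidedIdeal.mem_bot A).2 (hzero a ha))
    obtain ⟨x, hxJ, hx, hxb⟩ := h (star a * a) (star_mul_self_nonneg a)
      fun h0 ↦ ha0 (CStarRing.star_mul_self_eq_zero_iff a |>.1 h0)
    exact ⟨x * (star a * a), J.mul_mem_right _ _ hxJ,
      I.mul_mem_left _ _ (I.mul_mem_left _ _ haI),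
      fun h0 ↦ hx.ne' (CStarAlgebra.eq_zero_of_le_of_mul_eq_zero hx.le hxb h0)⟩
end

section
/- Every compact subset K of the positive cone of a C*-algebra B has an upper bound in B: there exists a positive element u ∈ B with k ≤ u for all k ∈ K. -/
/-- A finite set of self-adjoint elements of norm less than `r` has a positive upper bound of
norm less than `r`. -/
lemma exists_nonneg_norm_lt_upperBound_of_finite {B : Type*} [NonUnitalCStarAlgebra B]
    [PartialOrder B] [StarOrderedRing B] {r : ℝ} (hr : 0 < r) {s : Set B} (hs : s.Finite)
    (hsa : ∀ a ∈ s, IsSelfAdjoint a) (hnorm : ∀ a ∈ s, ‖a‖ < r) :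
    ∃ u : B, 0 ≤ u ∧ ‖u‖ < r ∧ ∀ a ∈ s, a ≤ u := by
  induction s, hs using Set.Finite.induction_on with
  | empty => exact ⟨0, le_rfl, by simpa using hr, by simp⟩
  | @insert a s _ _ ih =>
    obtain ⟨u, hu, hur, hsu⟩ := ih (fun b hb ↦ hsa b (.inr hb)) fun b hb ↦ hnorm b (.inr hb)
    have scale_mem : ∀ x : B, 0 ≤ x → ‖x‖ < r →
        r⁻¹ • x ∈ {x : B | 0 ≤ x} ∩ Metric.ball 0 1 := by
      refine fun x hx hxr ↦ ⟨smul_nonneg (inv_nonneg.2 hr.le) hx, ?_⟩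
      rw [mem_ball_zero_iff, norm_smul, norm_inv, Real.norm_of_nonneg hr.le, inv_mul_lt_one₀ hr]
      exact hxr
    obtain ⟨z, ⟨hz, hz'⟩, haz, huz⟩ := CStarAlgebra.directedOn_nonneg_ball
      _ (scale_mem a⁺ (CFC.posPart_nonneg a)
        ((CStarAlgebra.norm_posPart_le a).trans_lt (hnorm a (.inl rfl))))
      _ (scale_mem u hu hur)
    have haz : a⁺ ≤ r • z := (inv_smul_le_iff_of_pos hr).1 haz
    have huz : u ≤ r • z := (inv_smul_le_iff_of_pos hr).1 huz
    refine ⟨r • z, smul_nonneg hr.le hz, ?_, ?_⟩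
    · rw [norm_smul, Real.norm_of_nonneg hr.le]
      exact mul_lt_of_lt_one_right hr (mem_ball_zero_iff.1 hz')
    · rintro b (rfl | hb)
      · exact (CFC.le_posPart (hsa b (.inl rfl))).trans haz
      · exact (hsu b hb).trans huz

/-- Every compact subset of the positive cone of a C*-algebra has an upper bound. -/
theorem stmt_11 {B : Type*} [NonUnitalCStarAlgebra B] [PartialOrder B] [StarOrderedRing B]
    (K : Set B) (hKpos : ∀ k ∈ K, 0 ≤ k) (hK : IsCompact K) :
    ∃ u : B, 0 ≤ u ∧ ∀ k ∈ K, k ≤ u := by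
  have hpos (n : ℕ) : (0 : ℝ) < (1 / 2) ^ n := by positivity
  choose F hFK hF hcover using fun n : ℕ ↦ hK.finite_cover_balls (half_pos (hpos n))
  have diff_bound (n : ℕ) : ∃ u : B, 0 ≤ u ∧ ‖u‖ < 2 * (1 / 2) ^ n ∧
      ∀ a ∈ F (n + 1), ∀ b ∈ F n, ‖a - b‖ < 2 * (1 / 2) ^ n → a - b ≤ u := by
    obtain ⟨u, hu, hun, hle⟩ := exists_nonneg_norm_lt_upperBound_of_finite
      (s := Set.image2 (· - ·) (F (n + 1)) (F n) ∩ {d | ‖d‖ < 2 * (1 / 2) ^ n})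
      (mul_pos two_pos (hpos n)) (((hF (n + 1)).image2 _ (hF n)).inter_of_left _)
      (by
        rintro _ ⟨⟨a, ha, b, hb, rfl⟩, -⟩
        exact (hKpos a (hFK _ ha)).isSelfAdjoint.sub (hKpos b (hFK _ hb)).isSelfAdjoint)
      (fun d hd ↦ hd.2)
    exact ⟨u, hu, hun, fun a ha b hb h ↦ hle _ ⟨⟨a, ha, b, hb, rfl⟩, h⟩⟩
  choose v hv hvn hdiff using diff_bound
  have hsum : Summable v := Summable.of_norm_bounded
    (summable_geometric_two.mul_left 2) fun n ↦ (hvn n).le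
  obtain ⟨C, hC⟩ := (hF 0).isBounded.exists_norm_le
  obtain ⟨w, hw, -, hFw⟩ := exists_nonneg_norm_lt_upperBound_of_finite
    (r := max C 0 + 1) (by positivity) (hF 0)
    (fun a ha ↦ (hKpos a (hFK _ ha)).isSelfAdjoint)
    (fun a ha ↦ ((hC a ha).trans (le_max_left C 0)).trans_lt (lt_add_one _))
  refine ⟨w + ∑' n, v n, add_nonneg hw (tsum_nonneg hv), fun k hk ↦ ?_⟩
  have approx (n : ℕ) : ∃ a ∈ F n, dist k a < (1 / 2) ^ n / 2 := by
    simpa using hcover n hk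
  choose a haF hak using approx
  have ha_le (n : ℕ) : a n ≤ w + ∑ i ∈ Finset.range n, v i := by
    induction n with
    | zero => simpa using hFw _ (haF 0)
    | succ n ih =>
      have hd : ‖a (n + 1) - a n‖ < 2 * (1 / 2) ^ n := by
        rw [← dist_eq_norm]
        have h₁ := dist_triangle_left (a (n + 1)) (a n) k
        have h₂ := hak (n + 1)
        have h₃ := hak n
        have h₄ := hpos n
        rw [pow_succ] at h₂
        linarith
      have h := add_le_add ih (hdiff n _ (haF _) _ (haF _) hd)
      rwa [add_sub_cancel, add_assoc, ← Finset.sum_range_succ] at h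
  have ha_lim : Filter.Tendsto a Filter.atTop (nhds k) := by
    rw [tendsto_iff_dist_tendsto_zero]
    refine squeeze_zero (fun _ ↦ dist_nonneg) (fun n ↦ ?_)
      (tendsto_pow_atTop_nhds_zero_of_lt_one (r := (1 / 2 : ℝ)) (by norm_num) (by norm_num))
    rw [dist_comm]
    linarith [hak n, hpos n]
  exact le_of_tendsto' ha_lim fun n ↦
    (ha_le n).trans (add_le_add_right (hsum.sum_le_tsum _ fun i _ ↦ hv i) w)
end
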